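/- There exists an absolute constant C > 0 such that the following holds. Let d ≥ 1, T ≥ 1, let X ⊆ ℝ^d be nonempty with ℓ∞-diameter at most D, let α, β ≥ 0, η > 0, L ≥ 0, and let f_1, …, f_T : X → ℝ each be L-Lipschitz with respect to the ℓ1 norm. Let μ_η be the product probability measure on ℝ^d whose coordinates are i.i.d. exponential with parameter η. Suppose x_1, …, x_T : ℝ^d → X are measurable maps such that for μ_η-almost every σ and every t ∈ {1, …, T}, x_t(σ) is an (α,β)-approximate minimizer over X of x ↦ Σ_{i=1}^{t-1} f_i(x) − ⟨σ, x⟩. Then E_{σ∼μ_η}[ Σ_{t=1}^T f_t(x_t(σ)) − inf_{x∈X} Σ_{t=1}^T f_t(x) ] ≤ C ( η d² D L² T + d(βT + D)/η + αT + βdLT ). -/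

import Mathlib

open MeasureTheory

noncomputable section

/-- The exponential distribution with rate `η`: density `η * exp (-η x)` on `[0, ∞)`,
so that `P (Z ≥ s) = exp (-η s)` for `s ≥ 0`. -/
def expoMeasure (η : ℝ) : Measure ℝ :=
  volume.withDensity fun x => ENNReal.ofReal (if 0 ≤ x then η * Real.exp (-(η * x)) else 0)

instance (η : ℝ) : SigmaFinite (expoMeasure η) := by
  unfold expoMeasure; infer_instance

/-- The product probability measure on `ℝ^d` whose coordinates are i.i.d. `Exp(η)`. -/
def expoProd (d : ℕ) (η : ℝ) : Measure (Fin d → ℝ) :=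
  Measure.pi fun _ => expoMeasure η

/-- Standard inner product on `ℝ^d`. -/
def dotp {d : ℕ} (σ x : Fin d → ℝ) : ℝ := ∑ i, σ i * x i

/-- ℓ1 norm on `ℝ^d`. -/
def l1 {d : ℕ} (x : Fin d → ℝ) : ℝ := ∑ i, |x i|

theorem expo_meas_pdf (η : ℝ) : Measurable
    (fun x : ℝ => ENNReal.ofReal (if 0 ≤ x then η * Real.exp (-(η * x)) else 0)) := by
  refine ENNReal.measurable_ofReal.comp (Measurable.ite measurableSet_Ici ?_ ?_) <;> fun_prop

theorem expo_prob {η : ℝ} (hη : 0 < η) : IsProbabilityMeasure (expoMeasure η) := by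
  constructor
  rw [expoMeasure, withDensity_apply _ MeasurableSet.univ, Measure.restrict_univ]
  rw [← ProbabilityTheory.lintegral_exponentialPDF_eq_one hη]
  simp only [ProbabilityTheory.exponentialPDF_eq]

theorem expo_lintegral_abs {η : ℝ} (hη : 0 < η) :
    ∫⁻ x, ENNReal.ofReal |x| ∂(expoMeasure η) = ENNReal.ofReal (1 / η) := by
  rw [expoMeasure, lintegral_withDensity_eq_lintegral_mul _ (expo_meas_pdf η) (by fun_prop)]
  have h : ∀ x : ℝ, ((fun x : ℝ => ENNReal.ofReal (if 0 ≤ x then η * Real.exp (-(η * x)) else 0))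
      * fun x => ENNReal.ofReal |x|) x =
      ENNReal.ofReal (1 / η) * ProbabilityTheory.gammaPDF 2 η x := by
    intro x
    have h1 : 0 ≤ (if 0 ≤ x then η * Real.exp (-(η * x)) else 0) := by
      split_ifs <;> positivity
    rw [Pi.mul_apply, ← ENNReal.ofReal_mul h1, ProbabilityTheory.gammaPDF,
      ← ENNReal.ofReal_mul (by positivity)]
    congr 1
    rw [ProbabilityTheory.gammaPDFReal]
    split_ifs with hx
    · have h2 : (2 : ℝ) - 1 = 1 := by norm_num
      rw [abs_of_nonneg hx, Real.Gamma_two, h2, Real.rpow_one, Real.rpow_two]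
      field_simp
    · simp
  rw [lintegral_congr h, lintegral_const_mul' _ _ ENNReal.ofReal_ne_top,
    ProbabilityTheory.lintegral_gammaPDF_eq_one (by norm_num) hη, mul_one]

theorem expo_integrable_abs {η : ℝ} (hη : 0 < η) :
    Integrable (fun x : ℝ => |x|) (expoMeasure η) := by
  refine ⟨by fun_prop, ?_⟩
  rw [hasFiniteIntegral_iff_ofReal (by filter_upwards with x using abs_nonneg x),
    expo_lintegral_abs hη]
  exact ENNReal.ofReal_lt_top

theorem expo_integral_abs {η : ℝ} (hη : 0 < η) :
    ∫ x, |x| ∂(expoMeasure η) = 1 / η := by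
  rw [integral_eq_lintegral_of_nonneg_ae (by filter_upwards with x using abs_nonneg x)
    (by fun_prop), expo_lintegral_abs hη, ENNReal.toReal_ofReal (by positivity)]

theorem expoProd_prob (d : ℕ) {η : ℝ} (hη : 0 < η) : IsProbabilityMeasure (expoProd d η) := by
  have := expo_prob hη
  unfold expoProd; infer_instance

theorem expoProd_integrable_l1 (d : ℕ) {η : ℝ} (hη : 0 < η) :
    Integrable (fun σ : Fin d → ℝ => l1 σ) (expoProd d η) := by
  have := expo_prob hη
  unfold l1 expoProd
  refine integrable_finsetSum _ fun i _ => ?_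
  exact integrable_comp_eval (μ := fun _ : Fin d => expoMeasure η) (f := fun x : ℝ => |x|)
    (expo_integrable_abs hη)

theorem expoProd_integral_l1 (d : ℕ) {η : ℝ} (hη : 0 < η) :
    ∫ σ : Fin d → ℝ, l1 σ ∂(expoProd d η) = d / η := by
  have := expo_prob hη
  unfold l1 expoProd
  rw [integral_finsetSum]
  · have : ∀ i : Fin d, ∫ σ : Fin d → ℝ, |σ i| ∂(Measure.pi fun _ => expoMeasure η) = 1 / η := by
      intro i
      rw [integral_comp_eval (μ := fun _ : Fin d => expoMeasure η) (f := fun x : ℝ => |x|)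
        (by fun_prop)]
      exact expo_integral_abs hη
    simp only [this]
    simp [div_eq_mul_inv]
  · intro i _
    exact integrable_comp_eval (μ := fun _ : Fin d => expoMeasure η) (f := fun x : ℝ => |x|)
      (expo_integrable_abs hη)

theorem expo_shift_lintegral {η c : ℝ} (hη : 0 < η) (hc : 0 ≤ c) (g : ℝ → ENNReal)
    (hg : Measurable g) :
    ∫⁻ x, g (x + c) ∂(expoMeasure η) ≤
      ∫⁻ x, ENNReal.ofReal (Real.exp (η * c)) * g x ∂(expoMeasure η) := by
  rw [expoMeasure, lintegral_withDensity_eq_lintegral_mul _ (expo_meas_pdf η) (by fun_prop),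
    lintegral_withDensity_eq_lintegral_mul _ (expo_meas_pdf η) (by fun_prop)]
  refine le_of_le_of_eq ?_ (lintegral_add_right_eq_self (μ := (volume : Measure ℝ)) _ c)
  refine lintegral_mono fun x => ?_
  simp only [Pi.mul_apply]
  rw [← mul_assoc, ← ENNReal.ofReal_mul (by split_ifs <;> positivity)]
  gcongr
  by_cases hx : 0 ≤ x
  · rw [if_pos hx, if_pos (by linarith), mul_assoc, ← Real.exp_add]
    apply le_of_eq; congr 2; ring
  · rw [if_neg hx]
    have : 0 ≤ (if 0 ≤ x + c then η * Real.exp (-(η * (x + c))) else 0) := by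
      split_ifs <;> positivity
    positivity

theorem expoProd_shift_lintegral {d : ℕ} {η c : ℝ} (hη : 0 < η) (hc : 0 ≤ c) (i : Fin d)
    (g : (Fin d → ℝ) → ENNReal) (hg : Measurable g) :
    ∫⁻ σ, g (σ + Pi.single i c) ∂(expoProd d η) ≤
      ENNReal.ofReal (Real.exp (η * c)) * ∫⁻ σ, g σ ∂(expoProd d η) := by
  classical
  rw [← lintegral_const_mul _ hg, expoProd, lintegral_eq_lmarginal_univ (fun _ => (0:ℝ)),
    lintegral_eq_lmarginal_univ (fun _ => (0:ℝ)),
    lmarginal_erase' _ (by fun_prop) (Finset.mem_univ i),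
    lmarginal_erase' _ (by fun_prop) (Finset.mem_univ i)]
  refine lmarginal_mono (fun σ => ?_) _
  have : ∀ y : ℝ, Function.update σ i y + Pi.single i c = Function.update σ i (y + c) := by
    intro y; ext j
    by_cases h : j = i
    · subst h; simp
    · simp [h]
  simp only [this]
  exact expo_shift_lintegral hη hc (fun y => g (Function.update σ i y))
    (hg.comp (measurable_update σ))

theorem expoProd_shift_le {d : ℕ} {η c : ℝ} (hη : 0 < η) (hc : 0 ≤ c) (i : Fin d) :
    (expoProd d η).map (fun σ => σ + Pi.single i c) ≤
      ENNReal.ofReal (Real.exp (η * c)) • expoProd d η := by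
  rw [Measure.le_iff]
  intro s hs
  have hm : Measurable (fun σ : Fin d → ℝ => σ + Pi.single i c) := by fun_prop
  rw [Measure.smul_apply, smul_eq_mul, ← lintegral_indicator_one hs, ← lintegral_indicator_one hs,
    lintegral_map (measurable_one.indicator hs) hm]
  exact expoProd_shift_lintegral hη hc i _ (measurable_one.indicator hs)

theorem expoProd_shift_ae {d : ℕ} {η c : ℝ} (hη : 0 < η) (hc : 0 ≤ c) (i : Fin d)
    {p : (Fin d → ℝ) → Prop} (h : ∀ᵐ σ ∂(expoProd d η), p σ) :
    ∀ᵐ σ ∂(expoProd d η), p (σ + Pi.single i c) := by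
  have hm : Measurable (fun σ : Fin d → ℝ => σ + Pi.single i c) := by fun_prop
  refine ae_of_ae_map hm.aemeasurable (p := p) ?_
  have : (expoProd d η).map (fun σ => σ + Pi.single i c) ≪ expoProd d η :=
    (Measure.absolutelyContinuous_of_le (expoProd_shift_le hη hc i)).trans
      (Measure.smul_absolutelyContinuous)
  exact this.ae_le h

theorem expoProd_shift_integral {d : ℕ} {η c : ℝ} (hη : 0 < η) (hc : 0 ≤ c) (i : Fin d)
    (g : (Fin d → ℝ) → ℝ) (hg : Measurable g) (h0 : ∀ᵐ σ ∂(expoProd d η), 0 ≤ g σ)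
    (hi : Integrable g (expoProd d η)) :
    ∫ σ, g (σ + Pi.single i c) ∂(expoProd d η) ≤
      Real.exp (η * c) * ∫ σ, g σ ∂(expoProd d η) := by
  have hm : Measurable (fun σ : Fin d → ℝ => σ + Pi.single i c) := by fun_prop
  have he := integral_map (μ := expoProd d η) hm.aemeasurable (f := g) hg.aestronglyMeasurable
  rw [← he]
  refine (integral_mono_measure (expoProd_shift_le hη hc i) ?_ ?_).trans ?_
  · exact Measure.smul_absolutelyContinuous.ae_le h0
  · exact hi.smul_measure ENNReal.ofReal_ne_top
  · rw [integral_smul_measure, ENNReal.toReal_ofReal (by positivity), smul_eq_mul]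

theorem dotp_shift {d : ℕ} (σ x : Fin d → ℝ) (i : Fin d) (c : ℝ) :
    dotp (σ + Pi.single i c) x = dotp σ x + c * x i := by
  classical
  unfold dotp
  simp only [Pi.add_apply, add_mul, Finset.sum_add_distrib]
  congr 1
  rw [Finset.sum_eq_single i]
  · simp
  · intro j _ hj; simp [hj]
  · simp

theorem l1_shift {d : ℕ} (σ : Fin d → ℝ) (i : Fin d) {c : ℝ} (hc : 0 ≤ c) :
    l1 (σ + Pi.single i c) ≤ l1 σ + c := by
  classical
  unfold l1
  have h : ∑ j, |(Pi.single i c : Fin d → ℝ) j| = c := by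
    rw [Finset.sum_eq_single i]
    · simp [abs_of_nonneg hc]
    · intro j _ hj; simp [hj]
    · simp
  calc ∑ j, |(σ + Pi.single i c : Fin d → ℝ) j| ≤ ∑ j, (|σ j| + |(Pi.single i c : Fin d → ℝ) j|) :=
        Finset.sum_le_sum fun j _ => abs_add_le _ _
    _ = _ := by rw [Finset.sum_add_distrib, h]

/-- Pointwise monotonicity of approximate minimizers under a shift of one coordinate. -/
theorem ftpl_pointwise {d : ℕ} {X : Set (Fin d → ℝ)} {α β L c : ℝ} (hβ : 0 ≤ β)
    (hL : 0 ≤ L) (hc : 0 < c) (F f : (Fin d → ℝ) → ℝ)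
    (hf : ∀ x ∈ X, ∀ y ∈ X, |f x - f y| ≤ L * l1 (x - y))
    (i : Fin d) (σ u v u' v' : Fin d → ℝ)
    (hu : u ∈ X ∧ ∀ y ∈ X, F u - dotp σ u ≤ F y - dotp σ y + (α + β * l1 σ))
    (hv : v ∈ X ∧ ∀ y ∈ X, F v + f v - dotp σ v ≤ F y + f y - dotp σ y + (α + β * l1 σ))
    (hu' : u' ∈ X ∧ ∀ y ∈ X, F u' - dotp (σ + Pi.single i c) u' ≤
      F y - dotp (σ + Pi.single i c) y + (α + β * l1 (σ + Pi.single i c)))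
    (hv' : v' ∈ X ∧ ∀ y ∈ X, F v' + f v' - dotp (σ + Pi.single i c) v' ≤
      F y + f y - dotp (σ + Pi.single i c) y + (α + β * l1 (σ + Pi.single i c))) :
    max (u i) (v i) - (L / c * l1 (u - v) + 3 * (α + β * l1 σ) / c + β)
      ≤ min (u' i) (v' i) := by
  simp only [dotp_shift] at hu' hv'
  have hs := mul_le_mul_of_nonneg_left (l1_shift σ i hc.le) hβ
  obtain ⟨hl1, hl2⟩ := abs_le.1 (hf u hu.1 v hv.1)
  have hl : 0 ≤ l1 (u - v) := Finset.sum_nonneg fun _ _ => abs_nonneg _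
  have hLl : 0 ≤ L * l1 (u - v) := mul_nonneg hL hl
  have e1 := hu.2 u hu.1
  have e2 := hu.2 v hv.1
  have e3 := hu.2 u' hu'.1
  have e5 := hv.2 u hu.1
  have e8 := hv.2 v' hv'.1
  have a1 := hu'.2 u hu.1
  have a2 := hu'.2 v hv.1
  have a3 := hv'.2 u hu.1
  have a4 := hv'.2 v hv.1
  have key : L / c * l1 (u - v) + 3 * (α + β * l1 σ) / c + β =
      (L * l1 (u - v) + 3 * (α + β * l1 σ) + β * c) / c := by
    field_simp
  have red : ∀ a b : ℝ, c * a - (L * l1 (u - v) + 3 * (α + β * l1 σ) + β * c) ≤ c * b →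
      a - (L / c * l1 (u - v) + 3 * (α + β * l1 σ) / c + β) ≤ b := by
    intro a b h
    rw [key, sub_le_iff_le_add, ← sub_le_iff_le_add', le_div_iff₀ hc]
    linarith
  rcases max_choice (u i) (v i) with h | h <;> rw [h] <;> refine le_min ?_ ?_ <;>
    apply red <;> nlinarith

theorem ftpl_stab {d : ℕ} (hd : 1 ≤ d) {X : Set (Fin d → ℝ)} (hX : X.Nonempty)
    {D α β η L : ℝ} (hD : ∀ x ∈ X, ∀ y ∈ X, ∀ i, |x i - y i| ≤ D)
    (hβ : 0 ≤ β) (hη : 0 < η) (hL : 0 < L) (F f : (Fin d → ℝ) → ℝ)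
    (hf : ∀ x ∈ X, ∀ y ∈ X, |f x - f y| ≤ L * l1 (x - y))
    (u v : (Fin d → ℝ) → (Fin d → ℝ)) (hum : Measurable u) (hvm : Measurable v)
    (hu : ∀ᵐ σ ∂(expoProd d η), u σ ∈ X ∧ ∀ y ∈ X,
      F (u σ) - dotp σ (u σ) ≤ F y - dotp σ y + (α + β * l1 σ))
    (hv : ∀ᵐ σ ∂(expoProd d η), v σ ∈ X ∧ ∀ y ∈ X,
      F (v σ) + f (v σ) - dotp σ (v σ) ≤ F y + f y - dotp σ y + (α + β * l1 σ)) :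
    Integrable (fun σ => l1 (u σ - v σ)) (expoProd d η) ∧
    L * ∫ σ, l1 (u σ - v σ) ∂(expoProd d η) ≤
      8 * (η * d ^ 2 * D * L ^ 2) + 3 * (α + β * (d / η)) + 2 * (β * d * L) := by
  obtain ⟨x0, hx0⟩ := hX
  have hprob := expoProd_prob d hη
  have hum' : ∀ i, Measurable (fun σ => u σ i) := fun i => (measurable_pi_apply i).comp hum
  have hvm' : ∀ i, Measurable (fun σ => v σ i) := fun i => (measurable_pi_apply i).comp hvm
  have hdpos : (0:ℝ) < d := by exact_mod_cast hd
  have hD0 : 0 ≤ D := (abs_nonneg _).trans (hD x0 hx0 x0 hx0 ⟨0, hd⟩)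
  have hdi : ∀ i, Integrable (fun σ => |u σ i - v σ i|) (expoProd d η) := by
    intro i
    refine Integrable.of_bound ((hum' i).sub (hvm' i)).abs.aestronglyMeasurable D ?_
    filter_upwards [hu, hv] with σ h1 h2
    rw [Real.norm_eq_abs, abs_abs]
    exact hD _ h1.1 _ h2.1 i
  have hl1eq : ∀ σ, l1 (u σ - v σ) = ∑ i, |u σ i - v σ i| := fun σ => rfl
  have hint : Integrable (fun σ => l1 (u σ - v σ)) (expoProd d η) := by
    simp only [hl1eq]
    exact integrable_finsetSum _ fun i _ => hdi i
  refine ⟨hint, ?_⟩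
  set c : ℝ := 2 * L * d with hc_def
  have hc : 0 < c := by positivity
  set I := ∫ σ, l1 (u σ - v σ) ∂(expoProd d η) with hI
  have hA := expoProd_integral_l1 d hη
  have hAi := expoProd_integrable_l1 d hη
  have hcoord : ∀ i, ∫ σ, |u σ i - v σ i| ∂(expoProd d η) ≤
      η * c * (2 * D) + (L / c * I + 3 * (α + β * (d / η)) / c + β) := by
    intro i
    set g : (Fin d → ℝ) → ℝ := fun σ => min (u σ i) (v σ i) - (x0 i - D) with hg
    set M : (Fin d → ℝ) → ℝ := fun σ => max (u σ i) (v σ i) - (x0 i - D) with hM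
    have hgm : Measurable g := ((hum' i).min (hvm' i)).sub_const _
    have hMm : Measurable M := ((hum' i).max (hvm' i)).sub_const _
    have hgb : ∀ᵐ σ ∂(expoProd d η), 0 ≤ g σ ∧ g σ ≤ 2 * D ∧ 0 ≤ M σ ∧ M σ ≤ 2 * D := by
      filter_upwards [hu, hv] with σ h1 h2
      have b1 := abs_le.1 (hD _ h1.1 _ hx0 i)
      have b2 := abs_le.1 (hD _ h2.1 _ hx0 i)
      simp only [hg, hM]
      rcases le_total (u σ i) (v σ i) with h | h
      · rw [min_eq_left h, max_eq_right h]
        refine ⟨?_, ?_, ?_, ?_⟩ <;> linarith [b1.1, b1.2, b2.1, b2.2]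
      · rw [min_eq_right h, max_eq_left h]
        refine ⟨?_, ?_, ?_, ?_⟩ <;> linarith [b1.1, b1.2, b2.1, b2.2]
    have hgi : Integrable g (expoProd d η) := by
      refine Integrable.of_bound hgm.aestronglyMeasurable (2 * D) ?_
      filter_upwards [hgb] with σ h
      rw [Real.norm_eq_abs, abs_of_nonneg h.1]; exact h.2.1
    have hMi : Integrable M (expoProd d η) := by
      refine Integrable.of_bound hMm.aestronglyMeasurable (2 * D) ?_
      filter_upwards [hgb] with σ h
      rw [Real.norm_eq_abs, abs_of_nonneg h.2.2.1]; exact h.2.2.2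
    have hgb' := expoProd_shift_ae hη hc.le i hgb
    have hgsm : Measurable (fun σ : Fin d → ℝ => g (σ + Pi.single i c)) :=
      hgm.comp (by fun_prop)
    have hgsi : Integrable (fun σ => g (σ + Pi.single i c)) (expoProd d η) := by
      refine Integrable.of_bound hgsm.aestronglyMeasurable (2 * D) ?_
      filter_upwards [hgb'] with σ h
      rw [Real.norm_eq_abs, abs_of_nonneg h.1]; exact h.2.1
    -- change of measure
    have h1 := expoProd_shift_integral hη hc.le i g hgm
      (by filter_upwards [hgb] with σ h using h.1) hgi
    have hS0 : 0 ≤ ∫ σ, g (σ + Pi.single i c) ∂(expoProd d η) :=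
      integral_nonneg_of_ae (by filter_upwards [hgb'] with σ h using h.1)
    have hS1 : ∫ σ, g (σ + Pi.single i c) ∂(expoProd d η) ≤ 2 * D := by
      have := integral_mono_ae hgsi (integrable_const (2 * D))
        (by filter_upwards [hgb'] with σ h using h.2.1)
      simpa using this
    have h2 : ∫ σ, g (σ + Pi.single i c) ∂(expoProd d η) - η * c * (2 * D) ≤
        ∫ σ, g σ ∂(expoProd d η) := by
      set S := ∫ σ, g (σ + Pi.single i c) ∂(expoProd d η)
      set G := ∫ σ, g σ ∂(expoProd d η)
      have hexp : 1 - η * c ≤ Real.exp (-(η * c)) := by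
        have := Real.add_one_le_exp (-(η * c)); linarith
      have h3 : Real.exp (-(η * c)) * S ≤ G := by
        calc Real.exp (-(η * c)) * S ≤ Real.exp (-(η * c)) * (Real.exp (η * c) * G) := by gcongr
          _ = G := by rw [← mul_assoc, ← Real.exp_add]; simp
      have h4 : (1 - η * c) * S ≤ Real.exp (-(η * c)) * S := by gcongr
      have h5 : η * c * S ≤ η * c * (2 * D) := by gcongr
      linarith
    -- pointwise comparison
    have hEi : Integrable (fun σ => L / c * l1 (u σ - v σ) + 3 * (α + β * l1 σ) / c + β)
        (expoProd d η) := by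
      refine ((hint.const_mul _).add (Integrable.div_const (Integrable.const_mul
        ((integrable_const α).add (hAi.const_mul β)) 3) c)).add (integrable_const β)
    have hE : ∫ σ, (L / c * l1 (u σ - v σ) + 3 * (α + β * l1 σ) / c + β) ∂(expoProd d η) =
        L / c * I + 3 * (α + β * (d / η)) / c + β := by
      have i1 : Integrable (fun σ => L / c * l1 (u σ - v σ)) (expoProd d η) := hint.const_mul _
      have i2 : Integrable (fun σ : Fin d → ℝ => 3 * (α + β * l1 σ) / c) (expoProd d η) :=
        Integrable.div_const (Integrable.const_mul
        ((integrable_const α).add (hAi.const_mul β)) 3) c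
      have i3 : Integrable (fun σ : Fin d → ℝ => L / c * l1 (u σ - v σ) +
        3 * (α + β * l1 σ) / c) (expoProd d η) := i1.add i2
      rw [integral_add i3 (integrable_const β), integral_add i1 i2,
        integral_const_mul, integral_div, integral_const_mul,
        integral_add (integrable_const α) (hAi.const_mul β), integral_const_mul, hA]
      simp [hI]
    have h6 : ∫ σ, (M σ - (L / c * l1 (u σ - v σ) + 3 * (α + β * l1 σ) / c + β))
        ∂(expoProd d η) ≤ ∫ σ, g (σ + Pi.single i c) ∂(expoProd d η) := by
      refine integral_mono_ae (hMi.sub hEi) hgsi ?_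
      filter_upwards [hu, hv, expoProd_shift_ae hη hc.le i hu, expoProd_shift_ae hη hc.le i hv]
        with σ k1 k2 k3 k4
      have := ftpl_pointwise hβ hL.le hc F f hf i σ _ _ _ _ k1 k2 k3 k4
      simp only [hg, hM]
      linarith
    rw [integral_sub hMi hEi, hE] at h6
    have h7 : ∫ σ, |u σ i - v σ i| ∂(expoProd d η) =
        ∫ σ, M σ ∂(expoProd d η) - ∫ σ, g σ ∂(expoProd d η) := by
      rw [← integral_sub hMi hgi]
      refine integral_congr_ae (Filter.Eventually.of_forall fun σ => ?_)
      simp only [hg, hM]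
      rw [← max_sub_min_eq_abs']
      ring
    rw [h7]; linarith
  have hsum : I ≤ d * (η * c * (2 * D) + (L / c * I + 3 * (α + β * (d / η)) / c + β)) := by
    have : I = ∑ i, ∫ σ, |u σ i - v σ i| ∂(expoProd d η) := by
      rw [hI]; simp only [hl1eq]
      exact integral_finsetSum _ fun i _ => hdi i
    calc I = ∑ i, ∫ σ, |u σ i - v σ i| ∂(expoProd d η) := this
      _ ≤ ∑ i : Fin d, (η * c * (2 * D) + (L / c * I + 3 * (α + β * (d / η)) / c + β)) :=
        Finset.sum_le_sum fun i _ => hcoord i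
      _ = _ := by rw [Finset.sum_const, Finset.card_univ, Fintype.card_fin, nsmul_eq_mul]
  have hexpand : L * (d * (η * c * (2 * D) + (L / c * I + 3 * (α + β * (d / η)) / c + β))) =
      4 * (η * d ^ 2 * D * L ^ 2) + L * I / 2 + 3 * (α + β * (d / η)) / 2 + β * d * L := by
    rw [hc_def]; field_simp; ring
  have := mul_le_mul_of_nonneg_left hsum hL.le
  rw [hexpand] at this
  linarith

/-- Be-the-leader. -/
theorem ftpl_btl {d : ℕ} {X : Set (Fin d → ℝ)} (T : ℕ) (f : ℕ → (Fin d → ℝ) → ℝ)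
    (x : ℕ → (Fin d → ℝ)) (σ : Fin d → ℝ) (e : ℝ)
    (h : ∀ t < T, x t ∈ X ∧ ∀ y ∈ X, (∑ i ∈ Finset.range t, f i (x t)) - dotp σ (x t) ≤
      (∑ i ∈ Finset.range t, f i y) - dotp σ y + e) (n : ℕ) (hn : n < T) :
    ∀ y ∈ X, ∑ t ∈ Finset.range n, f t (x (t + 1)) ≤
      (∑ t ∈ Finset.range n, f t y) - dotp σ y + dotp σ (x 0) + (n + 1) * e := by
  induction n with
  | zero =>
    intro y hy
    have := (h 0 hn).2 y hy
    simp at this ⊢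
    linarith
  | succ n ih =>
    intro y hy
    have h1 := ih (by omega) (x (n + 1)) (h (n + 1) hn).1
    have h2 := (h (n + 1) hn).2 y hy
    rw [Finset.sum_range_succ]
    rw [Finset.sum_range_succ (fun i => f i (x (n + 1)))] at h2
    push_cast
    linarith

theorem dotp_sub_le {d : ℕ} (σ a b : Fin d → ℝ) {D : ℝ} (h : ∀ i, |a i - b i| ≤ D) :
    dotp σ a - dotp σ b ≤ D * l1 σ := by
  unfold dotp l1
  rw [← Finset.sum_sub_distrib, Finset.mul_sum]
  refine Finset.sum_le_sum fun i _ => ?_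
  calc σ i * a i - σ i * b i = σ i * (a i - b i) := by ring
    _ ≤ |σ i * (a i - b i)| := le_abs_self _
    _ = |σ i| * |a i - b i| := abs_mul _ _
    _ ≤ |σ i| * D := by gcongr; exact h i
    _ = _ := mul_comm _ _

theorem l1_sub_le {d : ℕ} (a b : Fin d → ℝ) {D : ℝ} (h : ∀ i, |a i - b i| ≤ D) :
    l1 (a - b) ≤ d * D := by
  calc l1 (a - b) ≤ ∑ _i : Fin d, D := Finset.sum_le_sum fun i _ => h i
    _ = _ := by simp

/-- **Theorem 1 (Non-Convex FTPL).** Rounds are indexed `0, …, T-1`; for round `t`, the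
prediction `x t σ` is an `(α,β)`-approximate minimizer over `X` of
`∑_{i < t} f i (·) - ⟨σ,·⟩`, where `σ` has i.i.d. `Exp(η)` coordinates. Then the expected
regret is at most `C (η d² D L² T + d(βT + D)/η + αT + βdLT)` for an absolute constant
`C > 0`. -/
theorem ftpl_regret :
    ∃ C : ℝ, 0 < C ∧
      ∀ (d T : ℕ), 1 ≤ d → 1 ≤ T →
      ∀ (X : Set (Fin d → ℝ)), X.Nonempty →
      ∀ (D : ℝ), (∀ x ∈ X, ∀ y ∈ X, ∀ i, |x i - y i| ≤ D) →
      ∀ (α β η L : ℝ), 0 ≤ α → 0 ≤ β → 0 < η → 0 ≤ L →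
      ∀ (f : ℕ → (Fin d → ℝ) → ℝ),
        (∀ t < T, ∀ x ∈ X, ∀ y ∈ X, |f t x - f t y| ≤ L * l1 (x - y)) →
      ∀ (x : ℕ → (Fin d → ℝ) → (Fin d → ℝ)),
        (∀ t < T, Measurable (x t)) →
        (∀ᵐ σ ∂(expoProd d η), ∀ t < T, x t σ ∈ X ∧
          ∀ y ∈ X,
            (∑ i ∈ Finset.range t, f i (x t σ)) - dotp σ (x t σ) ≤
              (∑ i ∈ Finset.range t, f i y) - dotp σ y + (α + β * l1 σ)) →
      (∫ σ, ((∑ t ∈ Finset.range T, f t (x t σ)) -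
            sInf ((fun y => ∑ t ∈ Finset.range T, f t y) '' X)) ∂(expoProd d η)) ≤
        C * (η * d ^ 2 * D * L ^ 2 * T + d * (β * T + D) / η + α * T + β * d * L * T) := by
  refine ⟨10, by norm_num, ?_⟩
  intro d T hd hT X hX D hD α β η L hα hβ hη hL f hf x hx hmin
  obtain ⟨n, rfl⟩ : ∃ n, T = n + 1 := ⟨T - 1, by omega⟩
  obtain ⟨x0, hx0⟩ := id hX
  have hprob := expoProd_prob d hη
  have hdpos : (1:ℝ) ≤ d := by exact_mod_cast hd
  have hD0 : 0 ≤ D := (abs_nonneg _).trans (hD x0 hx0 x0 hx0 ⟨0, hd⟩)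
  have hA := expoProd_integral_l1 d hη
  have hAi := expoProd_integrable_l1 d hη
  have hstab : ∀ t < n,
      Integrable (fun σ => L * l1 (x t σ - x (t + 1) σ)) (expoProd d η) ∧
      ∫ σ, L * l1 (x t σ - x (t + 1) σ) ∂(expoProd d η) ≤
      8 * (η * d ^ 2 * D * L ^ 2) + 3 * (α + β * (d / η)) + 2 * (β * d * L) := by
    intro t ht
    rcases hL.eq_or_lt with h0 | hLpos
    · subst h0
      simp only [zero_mul]
      refine ⟨integrable_zero _ _ _, ?_⟩
      rw [integral_zero]; positivity
    · have := ftpl_stab hd hX hD hβ hη hLpos (α := α)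
        (fun y => ∑ i ∈ Finset.range t, f i y) (f t) (hf t (by omega)) (x t) (x (t + 1))
        (hx t (by omega)) (hx (t + 1) (by omega))
        (by filter_upwards [hmin] with σ h using h t (by omega))
        (by
          filter_upwards [hmin] with σ h
          have := h (t + 1) (by omega)
          simpa only [Finset.sum_range_succ] using this)
      refine ⟨this.1.const_mul L, ?_⟩
      rw [integral_const_mul]; exact this.2
  set R : (Fin d → ℝ) → ℝ := fun σ => (∑ t ∈ Finset.range n, L * l1 (x t σ - x (t + 1) σ)) +
    ((L * (d * D) + (n + 1) * α) + ((n + 1) * β + D) * l1 σ) with hR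
  have hRi1 : Integrable (fun σ => ∑ t ∈ Finset.range n, L * l1 (x t σ - x (t + 1) σ))
      (expoProd d η) :=
    integrable_finsetSum _ fun t ht => (hstab t (Finset.mem_range.1 ht)).1
  have hRi2 : Integrable (fun σ : Fin d → ℝ => ((n + 1) * β + D) * l1 σ) (expoProd d η) :=
    hAi.const_mul _
  have hRi3 : Integrable (fun σ : Fin d → ℝ => (L * (d * D) + (n + 1) * α) +
      ((n + 1) * β + D) * l1 σ) (expoProd d η) := (integrable_const _).add hRi2
  have hRi : Integrable R (expoProd d η) := hRi1.add hRi3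
  have hRint : ∫ σ, R σ ∂(expoProd d η) ≤
      n * (8 * (η * d ^ 2 * D * L ^ 2) + 3 * (α + β * (d / η)) + 2 * (β * d * L)) +
      ((L * (d * D) + (n + 1) * α) + ((n + 1) * β + D) * (d / η)) := by
    rw [hR, integral_add hRi1 hRi3, integral_add (integrable_const _) hRi2, integral_const_mul,
      hA, integral_finsetSum _ fun t ht => (hstab t (Finset.mem_range.1 ht)).1]
    have : ∑ t ∈ Finset.range n, ∫ σ, L * l1 (x t σ - x (t + 1) σ) ∂(expoProd d η) ≤
        ∑ _t ∈ Finset.range n,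
          (8 * (η * d ^ 2 * D * L ^ 2) + 3 * (α + β * (d / η)) + 2 * (β * d * L)) :=
      Finset.sum_le_sum fun t ht => (hstab t (Finset.mem_range.1 ht)).2
    rw [Finset.sum_const, Finset.card_range, nsmul_eq_mul] at this
    simp only [integral_const, probReal_univ, one_smul]
    linarith
  have hamgm : L * (d * D) ≤ η * d ^ 2 * D * L ^ 2 + D * (d / η) := by
    have h1 : L * d ≤ η * d ^ 2 * L ^ 2 + d / η := by
      rw [← sub_nonneg]
      have : η * d ^ 2 * L ^ 2 + d / η - L * d = ((η * L * d) ^ 2 + d - η * L * d) / η := by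
        field_simp
      rw [this]
      apply div_nonneg _ hη.le
      nlinarith [sq_nonneg (η * L * d - 1)]
    nlinarith
  have hn0 : (0:ℝ) ≤ n := Nat.cast_nonneg n
  have p1 : 0 ≤ η * d ^ 2 * D * L ^ 2 := by positivity
  have p2 : 0 ≤ β * (d / η) := by positivity
  have p3 : 0 ≤ β * d * L := by positivity
  have p4 : 0 ≤ D * (d / η) := by positivity
  have hfinal : n * (8 * (η * d ^ 2 * D * L ^ 2) + 3 * (α + β * (d / η)) + 2 * (β * d * L)) +
      ((L * (d * D) + (n + 1) * α) + ((n + 1) * β + D) * (d / η)) ≤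
      10 * (η * d ^ 2 * D * L ^ 2 * ((n + 1 : ℕ) : ℝ) + d * (β * ((n + 1 : ℕ) : ℝ) + D) / η +
        α * ((n + 1 : ℕ) : ℝ) + β * d * L * ((n + 1 : ℕ) : ℝ)) := by
    have e : d * (β * ((n + 1 : ℕ) : ℝ) + D) / η =
        (n + 1) * (β * (d / η)) + D * (d / η) := by push_cast; field_simp
    rw [e]; push_cast
    have q1 := mul_nonneg hn0 p1
    have q2 := mul_nonneg hn0 p2
    have q3 := mul_nonneg hn0 p3
    have q5 := mul_nonneg hn0 hα
    linarith
  have hpt : ∀ᵐ σ ∂(expoProd d η), ((∑ t ∈ Finset.range (n + 1), f t (x t σ)) -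
      sInf ((fun y => ∑ t ∈ Finset.range (n + 1), f t y) '' X)) ≤ R σ := by
    filter_upwards [hmin] with σ h
    rw [sub_le_comm]
    refine le_csInf (hX.image _) ?_
    rintro _ ⟨y, hy, rfl⟩
    have b := ftpl_btl (n + 1) f (fun t => x t σ) σ (α + β * l1 σ) h n (by omega) y hy
    have b2 := dotp_sub_le σ (x 0 σ) y (hD _ (h 0 (by omega)).1 _ hy)
    have b3 := (le_abs_self _).trans (hf n (by omega) _ (h n (by omega)).1 y hy)
    have b4 := mul_le_mul_of_nonneg_left (l1_sub_le (x n σ) y (hD _ (h n (by omega)).1 _ hy)) hL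
    have b5 : ∑ t ∈ Finset.range n, f t (x t σ) ≤ ∑ t ∈ Finset.range n, f t (x (t + 1) σ) +
        ∑ t ∈ Finset.range n, L * l1 (x t σ - x (t + 1) σ) := by
      rw [← Finset.sum_add_distrib]
      refine Finset.sum_le_sum fun t ht => ?_
      have ht := Finset.mem_range.1 ht
      have := (le_abs_self _).trans (hf t (by omega) _ (h t (by omega)).1 _
        (h (t + 1) (by omega)).1)
      linarith
    simp only [hR, Finset.sum_range_succ]
    linarith
  refine le_trans ?_ hfinal
  by_cases hi : Integrable (fun σ => (∑ t ∈ Finset.range (n + 1), f t (x t σ)) -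
      sInf ((fun y => ∑ t ∈ Finset.range (n + 1), f t y) '' X)) (expoProd d η)
  · exact (integral_mono_ae hi hRi hpt).trans hRint
  · rw [integral_undef hi]; positivity
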